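/- Let P ⊆ A be a finite-index inclusion of separable unital C*-algebras with the Rohlin property. If A is an AF algebra then P is an AF algebra. -/

import Mathlib

/-- A conditional expectation from a unital C*-algebra `A` onto a C*-subalgebra `P`. -/
structure IsCondExp {A : Type*} [NormedRing A] [StarRing A] [CStarRing A]
    [NormedAlgebra ℂ A] [CompleteSpace A] [StarModule ℂ A] [PartialOrder A]
    [StarOrderedRing A] (P : StarSubalgebra ℂ A) (E : A → A) : Prop where
  map_add : ∀ x y : A, E (x + y) = E x + E y
  map_smul : ∀ (c : ℂ) (x : A), E (c • x) = c • E x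
  mem : ∀ x : A, E x ∈ P
  fix : ∀ x ∈ P, E x = x
  bimod : ∀ p ∈ P, ∀ q ∈ P, ∀ x : A, E (p * x * q) = p * E x * q
  star_map : ∀ x : A, E (star x) = star (E x)
  pos : ∀ x : A, 0 ≤ E (star x * x)

/-- A quasi-basis `{(u i, v i)}` for a conditional expectation `E`. -/
def IsQuasiBasis {A : Type*} [Ring A] (E : A → A) {n : ℕ} (u v : Fin n → A) : Prop :=
  ∀ a : A, (a = ∑ i, u i * E (v i * a)) ∧ (a = ∑ i, E (a * u i) * v i)

/-- A sequence `(a n)` in a normed space is bounded. -/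
def IsBddSeq {A : Type*} [Norm A] (a : ℕ → A) : Prop := ∃ C : ℝ, ∀ n, ‖a n‖ ≤ C

/-- Data exhibiting the algebra `Ainf` as the quotient `A^∞ = ℓ^∞(ℕ, A)/c₀(A)` of
bounded sequences in `A` modulo null sequences; `q` is the quotient map (its values
on unbounded sequences are irrelevant). -/
structure SeqAlg (A : Type*) [NormedRing A] [StarRing A] [NormedAlgebra ℂ A]
    (Ainf : Type*) [Ring Ainf] [StarRing Ainf] [Algebra ℂ Ainf] where
  q : (ℕ → A) → Ainf
  surj : ∀ z : Ainf, ∃ a : ℕ → A, IsBddSeq a ∧ q a = z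
  q_add : ∀ a b : ℕ → A, IsBddSeq a → IsBddSeq b → q (a + b) = q a + q b
  q_mul : ∀ a b : ℕ → A, IsBddSeq a → IsBddSeq b → q (a * b) = q a * q b
  q_smul : ∀ (c : ℂ) (a : ℕ → A), IsBddSeq a → q (c • a) = c • q a
  q_star : ∀ a : ℕ → A, IsBddSeq a → q (star a) = star (q a)
  q_one : q 1 = 1
  q_eq_zero_iff : ∀ a : ℕ → A, IsBddSeq a →
    (q a = 0 ↔ Filter.Tendsto (fun n => ‖a n‖) Filter.atTop (nhds 0))

/-- The canonical embedding of `A` into `Ainf` as (classes of) constant sequences. -/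
def SeqAlg.incl {A : Type*} [NormedRing A] [StarRing A] [NormedAlgebra ℂ A]
    {Ainf : Type*} [Ring Ainf] [StarRing Ainf] [Algebra ℂ Ainf]
    (S : SeqAlg A Ainf) (x : A) : Ainf := S.q fun _ => x

/-- The hypotheses that `P ⊆ A` is an inclusion of unital C*-algebras with a
conditional expectation `E : A → P` of finite Watatani index (witnessed by a
quasi-basis with index sum `ind`, a central positive invertible element), having the
Rohlin property: there is a projection `e ∈ A_∞ = A^∞ ∩ A'` with
`E^∞(e) = (Index E)⁻¹ · 1` such that `x ↦ x e` is injective on `A`.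
Here `Ainf` plays the role of `A^∞ = ℓ^∞(ℕ,A)/c₀(A)` via `S : SeqAlg A Ainf`, and
`Einf` is the coordinatewise extension `E^∞`. -/
structure RohlinInclusion {A : Type*} [NormedRing A] [StarRing A] [CStarRing A]
    [NormedAlgebra ℂ A] [CompleteSpace A] [StarModule ℂ A] [PartialOrder A]
    [StarOrderedRing A] (P : StarSubalgebra ℂ A) (E : A → A)
    {Ainf : Type*} [Ring Ainf] [StarRing Ainf] [Algebra ℂ Ainf]
    (S : SeqAlg A Ainf) (Einf : Ainf → Ainf) where
  condExp : IsCondExp P E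
  -- finite index witnessed by a quasi-basis
  ind : A
  indInv : A
  quasiBasis : ∃ (n : ℕ) (u v : Fin n → A), IsQuasiBasis E u v ∧ ∑ i, u i * v i = ind
  ind_mem : ind ∈ P
  ind_central : ∀ a : A, Commute ind a
  ind_pos : 0 ≤ ind
  ind_mul_inv : ind * indInv = 1
  inv_mul_ind : indInv * ind = 1
  -- `E^∞` extends `E` coordinatewise
  Einf_compat : ∀ a : ℕ → A, IsBddSeq a → Einf (S.q a) = S.q fun n => E (a n)
  -- the Rohlin projection
  e : Ainf
  e_idem : e * e = e
  e_star : star e = e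
  e_comm : ∀ x : A, Commute e (S.incl x)
  e_exp : Einf e = S.incl indInv
  e_inj : ∀ x : A, S.incl x * e = 0 → x = 0

/-- A closed star-subalgebra `P` of a C*-algebra `A` is AF if every finite subset of
`P` can be approximated within any `ε > 0` by a finite-dimensional C*-subalgebra of
`P`. Taking `P = ⊤` gives the usual notion for `A`. -/
def IsAFSubalgebra {A : Type*} [NormedRing A] [StarRing A] [CStarRing A]
    [NormedAlgebra ℂ A] [CompleteSpace A] [StarModule ℂ A]
    (P : StarSubalgebra ℂ A) : Prop :=
  ∀ s : Finset A, (↑s ⊆ (P : Set A)) → ∀ ε : ℝ, 0 < ε →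
    ∃ R : StarSubalgebra ℂ A, R ≤ P ∧ FiniteDimensional ℂ R ∧
      ∀ x ∈ s, ∃ y ∈ R, ‖x - y‖ < ε

section

open Filter Topology

/-- A self-adjoint element `h` of a C*-algebra is of the form `star r * r` as soon as no
compression `k * h * k` is a nonzero negative element. -/
theorem CStarAlgebra.exists_eq_star_mul_self_of_compression {D : Type*} [CStarAlgebra D] {h : D}
    (hsa : star h = h)
    (hneg : ∀ k g : D, star k = k → k * h * k = -(star g * g) → g = 0) :
    ∃ r, h = star r * r := by
  let _ := CStarAlgebra.spectralOrder D
  have := CStarAlgebra.spectralOrderedRing D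
  have hm : 0 ≤ h⁻ := CFC.negPart_nonneg h
  have hmsa : star h⁻ = h⁻ := (IsSelfAdjoint.of_nonneg hm).star_eq
  have hs : star (CFC.sqrt h⁻) = CFC.sqrt h⁻ :=
    (IsSelfAdjoint.of_nonneg (CFC.sqrt_nonneg _)).star_eq
  have hss := CFC.sqrt_mul_sqrt_self h⁻ hm
  have hdec := CFC.posPart_sub_negPart h hsa
  have hcube : star (CFC.sqrt h⁻ * h⁻) * (CFC.sqrt h⁻ * h⁻) = h⁻ * h⁻ * h⁻ := by
    rw [star_mul, hs, hmsa, mul_assoc, ← mul_assoc (CFC.sqrt h⁻), hss, mul_assoc]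
  have hg := hneg h⁻ (CFC.sqrt h⁻ * h⁻) hmsa (by
    rw [hcube]
    conv_lhs => rw [← hdec]
    have h0 : (h⁺ - h⁻)⁻ = h⁻ := by rw [hdec]
    rw [h0, mul_sub, sub_mul, CFC.negPart_mul_posPart]
    simp)
  have hzero : h⁻ = 0 := by
    rw [hg, mul_zero] at hcube
    have h2 : h⁻ * h⁻ = 0 := by
      rw [← CStarRing.star_mul_self_eq_zero_iff (h⁻ * h⁻), star_mul, hmsa, ← mul_assoc, ← hcube,
        zero_mul]
    rw [← CStarRing.star_mul_self_eq_zero_iff h⁻, hmsa, h2]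
  have hpos : 0 ≤ h := by
    rw [← hdec, hzero, sub_zero]
    exact CFC.posPart_nonneg h
  refine ⟨CFC.sqrt h, ?_⟩
  rw [(IsSelfAdjoint.of_nonneg (CFC.sqrt_nonneg h)).star_eq, CFC.sqrt_mul_sqrt_self h hpos]

/-- A self-adjoint matrix over a C*-algebra none of whose diagonal compressions is a nonzero
negative element factors as `star R * R`. -/
theorem CStarAlgebra.exists_matrix_eq_star_mul_self {B : Type*} [CStarAlgebra B] {n : ℕ}
    (H : Fin n → Fin n → B) (hsa : ∀ i j, star (H i j) = H j i)
    (hneg : ∀ p g : Fin n → B,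
      ∑ i, ∑ j, star (p i) * H i j * p j = -∑ l, star (g l) * g l → ∀ l, g l = 0) :
    ∃ R : Fin n → Fin n → B, ∀ i j, H i j = ∑ k, star (R k i) * R k j := by
  let _ := CStarAlgebra.spectralOrder B
  have := CStarAlgebra.spectralOrderedRing B
  obtain ⟨r, hr⟩ := CStarAlgebra.exists_eq_star_mul_self_of_compression
    (D := CStarMatrix (Fin n) (Fin n) B) (h := CStarMatrix.ofMatrix (Matrix.of H))
    (by
      ext i j
      rw [CStarMatrix.star_apply]
      exact hsa j i)
    (by
      intro k g hk hkg
      ext l m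
      refine hneg (fun i => k i m) (fun l => g l m) ?_ l
      have := congrArg (fun M : CStarMatrix (Fin n) (Fin n) B => M m m) hkg
      simp only [CStarMatrix.mul_apply, CStarMatrix.neg_apply, CStarMatrix.star_apply] at this
      rw [← this, Finset.sum_comm]
      refine Finset.sum_congr rfl fun j _ => ?_
      rw [Finset.sum_mul]
      refine Finset.sum_congr rfl fun i _ => ?_
      rw [← CStarMatrix.star_apply, hk]
      rfl)
  refine ⟨fun i j => r i j, fun i j => ?_⟩
  have := congrArg (fun M : CStarMatrix (Fin n) (Fin n) B => M i j) hr
  simp only [CStarMatrix.mul_apply, CStarMatrix.star_apply] at this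
  exact this

/-- Matrix-unit style generators witnessing separability of a finite-dimensional semisimple
complex algebra. -/
theorem IsSemisimpleRing.exists_separability_system (F : Type*) [Ring F] [Algebra ℂ F]
    [IsSemisimpleRing F] [FiniteDimensional ℂ F] :
    ∃ (ι : Type) (_ : Fintype ι) (x y : ι → F) (c : F → ι → ι → ℂ),
      ∑ i, x i * y i = 1 ∧ (∀ a i, a * x i = ∑ j, c a j i • x j) ∧
        ∀ a i, y i * a = ∑ j, c a i j • y j := by
  classical
  obtain ⟨n, d, hd, ⟨Φ⟩⟩ := IsSemisimpleRing.exists_algEquiv_pi_matrix_of_isAlgClosed ℂ F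
  refine ⟨Σ k : Fin n, Fin (d k), inferInstance,
    fun p => Φ.symm (Pi.single p.1 (Matrix.single p.2 0 1)),
    fun p => Φ.symm (Pi.single p.1 (Matrix.single 0 p.2 1)),
    fun a p r => if h : r.1 = p.1 then Φ a p.1 p.2 (h ▸ r.2) else 0, ?_, ?_, ?_⟩
  · apply Φ.injective
    simp only [map_sum, map_mul, AlgEquiv.apply_symm_apply, map_one, Fintype.sum_sigma,
      ← Pi.single_mul, Matrix.single_mul_single_same, mul_one]
    have h1 : ∀ k, ∑ i, Pi.single (M := fun k => Matrix (Fin (d k)) (Fin (d k)) ℂ) k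
        (Matrix.single i i 1) = Pi.single k 1 := fun k => by
      rw [← Matrix.sum_single_one]
      exact (map_sum (AddMonoidHom.single (fun k => Matrix (Fin (d k)) (Fin (d k)) ℂ) k) _ _).symm
    rw [Finset.sum_congr rfl fun k _ => h1 k]
    exact Finset.univ_sum_single _
  · rintro a ⟨k, i⟩
    apply Φ.injective
    simp only [map_sum, map_mul, AlgEquiv.apply_symm_apply, map_smul, Fintype.sum_sigma]
    rw [Finset.sum_eq_single k (fun l _ hl => by simp [hl.symm]) (by simp)]
    ext l s t
    obtain rfl | hl := eq_or_ne k l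
    · simp [Matrix.mul_apply, Matrix.single_apply, Matrix.sum_apply, Finset.sum_apply, ite_and]
    · simp [hl.symm]
  · rintro a ⟨k, i⟩
    apply Φ.injective
    simp only [map_sum, map_mul, AlgEquiv.apply_symm_apply, map_smul, Fintype.sum_sigma]
    rw [Finset.sum_eq_single k (fun l _ hl => by simp [hl]) (by simp)]
    ext l s t
    obtain rfl | hl := eq_or_ne k l
    · simp [Matrix.mul_apply, Matrix.single_apply, Matrix.sum_apply, Finset.sum_apply, ite_and]
      split_ifs <;> simp
    · simp [hl.symm]

theorem isSemisimpleRing_of_star_mul_self_injective (F : Type*) [Ring F] [StarRing F] [Algebra ℂ F]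
    [FiniteDimensional ℂ F] (h : ∀ x : F, star x * x = 0 → x = 0) : IsSemisimpleRing F := by
  have : IsArtinianRing F := IsArtinianRing.of_finite ℂ F
  rw [IsArtinianRing.isSemisimpleRing_iff_jacobson, eq_bot_iff]
  intro x hx
  have hx' : star x * x ∈ Ring.jacobson F := Ideal.mul_mem_left _ _ hx
  obtain ⟨n, hn⟩ := IsSemiprimaryRing.isNilpotent (R := F)
  have hnil : (star x * x) ^ n = 0 := by
    have := Ideal.pow_mem_pow hx' n
    rw [hn] at this
    simpa using this
  have key : ∀ (m : ℕ) (z : F), star z = z → z ^ (2 ^ m) = 0 → z = 0 := by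
    intro m
    induction m with
    | zero => intro z _ hz; simpa using hz
    | succ m ih =>
      intro z hz hzm
      refine ih z hz (h _ ?_)
      rw [star_pow, hz, ← pow_add, ← two_mul, ← pow_succ']
      exact hzm
  refine (Submodule.mem_bot F).2 (h x (key n _ (by simp) ?_))
  exact pow_eq_zero_of_le Nat.lt_two_pow_self.le hnil

/-- `φ` is multiplicative and unital up to the error `ε`. -/
def IsApproxHom {F A : Type*} [NormedRing F] [NormedAlgebra ℂ F] [NormedRing A] [NormedAlgebra ℂ A]
    (φ : F →L[ℂ] A) (ε : ℝ) : Prop :=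
  (∀ a b, ‖φ (a * b) - φ a * φ b‖ ≤ ε * ‖a‖ * ‖b‖) ∧ ‖φ 1 - 1‖ ≤ ε

section Stability

variable {F A : Type*} [CStarAlgebra F] [CStarAlgebra A]

theorem IsApproxHom.exists_linear_correction {ι : Type*} [Fintype ι] {x y : ι → F}
    {c : F → ι → ι → ℂ} (hxy : ∑ i, x i * y i = 1) (hx : ∀ a i, a * x i = ∑ j, c a j i • x j)
    (hy : ∀ a i, y i * a = ∑ j, c a i j • y j) (P : StarSubalgebra ℂ A) {φ : F →L[ℂ] A} {ε K : ℝ}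
    (hε : 0 ≤ ε) (hφ : IsApproxHom φ ε) (hK : ‖φ‖ ≤ K) (hP : ∀ a, φ a ∈ P) :
    ∃ ψ : F →L[ℂ] A, (∀ a, ψ a ∈ P) ∧ (∀ a, ‖ψ a‖ ≤ K * (∑ i, ‖x i‖ * ‖y i‖) * ε * ‖a‖) ∧
      (∀ a b, ‖φ a * ψ b + ψ a * φ b - ψ (a * b) - (φ (a * b) - φ a * φ b)‖ ≤
        (1 + 2 * ∑ i, ‖x i‖ * ‖y i‖) * ε ^ 2 * ‖a‖ * ‖b‖) ∧
      ‖φ 1 + ψ 1 - 1‖ ≤ (1 + ∑ i, ‖x i‖ * ‖y i‖) * ε ^ 2 := by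
  set N := ∑ i, ‖x i‖ * ‖y i‖ with hN
  have hN0 : 0 ≤ N := Finset.sum_nonneg fun i _ => by positivity
  set m : F → F → A := fun a b => φ (a * b) - φ a * φ b with hm
  have hK0 : 0 ≤ K := (norm_nonneg _).trans hK
  have hmb : ∀ a b, ‖m a b‖ ≤ ε * ‖a‖ * ‖b‖ := hφ.1
  let ψ : F →L[ℂ] A := ∑ i, (ContinuousLinearMap.mul ℂ A (φ (x i))).comp
    (φ.comp (ContinuousLinearMap.mul ℂ F (y i)) - (ContinuousLinearMap.mul ℂ A (φ (y i))).comp φ)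
  have hψ : ∀ a, ψ a = ∑ i, φ (x i) * m (y i) a := fun a => by simp [ψ, m, mul_sub]
  have hsum : ‖∑ i, φ (x i) * φ (y i) - 1‖ ≤ (1 + N) * ε := by
    have : ∑ i, φ (x i) * φ (y i) - 1 = (φ 1 - 1) - ∑ i, m (x i) (y i) := by
      simp only [hm, Finset.sum_sub_distrib, ← map_sum, hxy]
      abel
    rw [this, add_mul, one_mul]
    refine (norm_sub_le _ _).trans (add_le_add hφ.2 ((norm_sum_le _ _).trans ?_))
    rw [hN, Finset.sum_mul]
    exact Finset.sum_le_sum fun i _ => (hmb _ _).trans_eq (by ring)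
  refine ⟨ψ, fun a => ?_, fun a => ?_, fun a b => ?_, ?_⟩
  · rw [hψ]
    exact sum_mem fun i _ => mul_mem (hP _) (sub_mem (hP _) (mul_mem (hP _) (hP _)))
  · rw [hψ]
    refine (norm_sum_le _ _).trans ?_
    rw [hN, Finset.mul_sum, Finset.sum_mul, Finset.sum_mul]
    refine Finset.sum_le_sum fun i _ => (norm_mul_le _ _).trans ?_
    calc ‖φ (x i)‖ * ‖m (y i) a‖ ≤ (K * ‖x i‖) * (ε * ‖y i‖ * ‖a‖) := by
          gcongr
          · exact φ.le_of_opNorm_le hK _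
          · exact hmb _ _
      _ = _ := by ring
  · have hmove : ∑ i, φ (a * x i) * m (y i) b = ∑ i, φ (x i) * m (y i * a) b := by
      have hml : ∀ i, m (y i * a) b = ∑ j, c a i j • m (y j) b := fun i => by
        simp only [hm, hy, Finset.sum_mul, map_sum, smul_mul_assoc, map_smul, smul_sub,
          Finset.sum_sub_distrib]
      simp only [hx, hml, map_sum, map_smul, Finset.sum_mul, Finset.mul_sum]
      rw [Finset.sum_comm]
      simp only [smul_mul_assoc, mul_smul_comm]
    have hcoc : ∀ z, m (z * a) b = φ z * m a b + m z (a * b) - m z a * φ b := fun z => by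
      simp only [hm, mul_assoc, mul_sub, sub_mul]
      abel
    have hkey : φ a * ψ b + ψ a * φ b - ψ (a * b) - m a b =
        (∑ i, φ (x i) * φ (y i) - 1) * m a b - ∑ i, m a (x i) * m (y i) b := by
      have h1 : φ a * ψ b = ∑ i, φ (a * x i) * m (y i) b - ∑ i, m a (x i) * m (y i) b := by
        rw [hψ, Finset.mul_sum, ← Finset.sum_sub_distrib]
        refine Finset.sum_congr rfl fun i _ => ?_
        simp only [hm]
        noncomm_ring
      rw [h1, hmove]
      simp only [hcoc, hψ, mul_sub, mul_add, Finset.sum_sub_distrib, Finset.sum_add_distrib,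
        Finset.sum_mul, sub_mul, one_mul, mul_assoc]
      abel
    rw [show φ (a * b) - φ a * φ b = m a b from rfl, hkey]
    have h2 : ‖∑ i, m a (x i) * m (y i) b‖ ≤ N * ε ^ 2 * ‖a‖ * ‖b‖ := by
      refine (norm_sum_le _ _).trans ?_
      rw [hN, Finset.sum_mul, Finset.sum_mul, Finset.sum_mul]
      refine Finset.sum_le_sum fun i _ => (norm_mul_le _ _).trans ?_
      calc ‖m a (x i)‖ * ‖m (y i) b‖ ≤ (ε * ‖a‖ * ‖x i‖) * (ε * ‖y i‖ * ‖b‖) := by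
            gcongr <;> exact hmb _ _
        _ = _ := by ring
    calc _ ≤ (1 + N) * ε * (ε * ‖a‖ * ‖b‖) + N * ε ^ 2 * ‖a‖ * ‖b‖ := by
          refine (norm_sub_le _ _).trans (add_le_add ((norm_mul_le _ _).trans ?_) h2)
          gcongr
          exact hmb _ _
      _ = _ := by ring
  · have : φ 1 + ψ 1 - 1 = (∑ i, φ (x i) * φ (y i) - 1) * (1 - φ 1) := by
      rw [hψ]
      simp only [hm, mul_one, mul_sub, sub_mul, one_mul, Finset.sum_sub_distrib, Finset.sum_mul,
        mul_assoc]
      abel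
    rw [this]
    calc _ ≤ (1 + N) * ε * ε := by
          refine (norm_mul_le _ _).trans ?_
          gcongr
          rw [norm_sub_rev]
          exact hφ.2
      _ = _ := by ring

theorem IsApproxHom.exists_improvement {ι : Type*} [Fintype ι] {x y : ι → F}
    {c : F → ι → ι → ℂ} (hxy : ∑ i, x i * y i = 1) (hx : ∀ a i, a * x i = ∑ j, c a j i • x j)
    (hy : ∀ a i, y i * a = ∑ j, c a i j • y j) (P : StarSubalgebra ℂ A) {φ : F →L[ℂ] A} {ε K : ℝ}
    (hε : 0 ≤ ε) (hφ : IsApproxHom φ ε) (hK : ‖φ‖ ≤ K) (hP : ∀ a, φ a ∈ P)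
    (hstar : ∀ a, φ (star a) = star (φ a)) :
    ∃ φ' : F →L[ℂ] A, (∀ a, φ' a ∈ P) ∧ (∀ a, φ' (star a) = star (φ' a)) ∧
      ‖φ' - φ‖ ≤ K * (∑ i, ‖x i‖ * ‖y i‖) * ε ∧
      IsApproxHom φ'
        ((1 + 2 * (∑ i, ‖x i‖ * ‖y i‖) + (K * ∑ i, ‖x i‖ * ‖y i‖) ^ 2) * ε ^ 2) := by
  obtain ⟨ψ, hψP, hψb, hψm, hψ1⟩ := hφ.exists_linear_correction hxy hx hy P hε hK hP
  set N := ∑ i, ‖x i‖ * ‖y i‖ with hN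
  have hN0 : 0 ≤ N := Finset.sum_nonneg fun i _ => by positivity
  have hK0 : 0 ≤ K := (norm_nonneg _).trans hK
  let χ : F →L[ℂ] A := (1 / 2 : ℂ) • (ψ + (((starL ℂ : A ≃L⋆[ℂ] A) : A →L⋆[ℂ] A).comp
    (ψ.comp ((starL ℂ : F ≃L⋆[ℂ] F) : F →L⋆[ℂ] F))))
  have hχ : ∀ a, χ a = (1 / 2 : ℂ) • (ψ a + star (ψ (star a))) := fun a => by simp [χ]
  have hhalf : ∀ (u v : A) (t : ℝ), ‖u‖ ≤ t → ‖v‖ ≤ t → ‖(1 / 2 : ℂ) • (u + v)‖ ≤ t := by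
    intro u v t hu hv
    rw [norm_smul]
    have := norm_add_le u v
    norm_num
    linarith
  have hχb : ∀ a, ‖χ a‖ ≤ K * N * ε * ‖a‖ := fun a => by
    rw [hχ]
    refine hhalf _ _ _ (hψb a) ?_
    rw [norm_star]
    exact (hψb _).trans_eq (by rw [norm_star])
  have hhs : ∀ u : A, star ((1 / 2 : ℂ) • u) = (1 / 2 : ℂ) • star u := fun u => by
    rw [star_smul]
    simp
  refine ⟨φ + χ, fun a => ?_, fun a => ?_, ?_, fun a b => ?_, ?_⟩
  · rw [add_apply, hχ]
    exact add_mem (hP _) (SMulMemClass.smul_mem _ (add_mem (hψP _) (star_mem (hψP _))))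
  · simp only [add_apply, hχ, hstar, star_add, hhs, star_star]
    rw [add_comm (star (ψ a))]
  · rw [add_sub_cancel_left]
    exact χ.opNorm_le_bound (by positivity) hχb
  · set r : F → F → A := fun a b =>
      φ a * ψ b + ψ a * φ b - ψ (a * b) - (φ (a * b) - φ a * φ b) with hr
    have hkey : (φ + χ) (a * b) - (φ + χ) a * (φ + χ) b =
        -((1 / 2 : ℂ) • (r a b + star (r (star b) (star a)))) - χ a * χ b := by
      have h1 : (1 / 2 : ℂ) • (r a b + star (r (star b) (star a))) =
          φ a * χ b + χ a * φ b - χ (a * b) - (φ (a * b) - φ a * φ b) := by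
        have h2 : φ (a * b) - φ a * φ b =
            (1 / 2 : ℂ) • ((φ (a * b) - φ a * φ b) + (φ (a * b) - φ a * φ b)) := by
          rw [← two_smul ℂ, smul_smul]
          norm_num
        rw [h2]
        simp only [hχ, mul_smul_comm, smul_mul_assoc, ← smul_add, ← smul_sub, hr]
        congr 1
        simp only [star_sub, star_add, star_mul, ← hstar, star_star]
        noncomm_ring
      rw [h1]
      simp only [add_apply]
      noncomm_ring
    rw [hkey]
    calc _ ≤ (1 + 2 * N) * ε ^ 2 * ‖a‖ * ‖b‖ + (K * N * ε * ‖a‖) * (K * N * ε * ‖b‖) := by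
          refine (norm_sub_le _ _).trans (add_le_add ?_ ((norm_mul_le _ _).trans ?_))
          · rw [norm_neg]
            refine hhalf _ _ _ (hψm a b) ?_
            rw [norm_star]
            refine (hψm _ _).trans_eq ?_
            rw [norm_star, norm_star]
            ring
          · gcongr <;> exact hχb _
      _ = _ := by ring
  · have h1 : (φ + χ) 1 - 1 = (1 / 2 : ℂ) • ((φ 1 + ψ 1 - 1) + star (φ 1 + ψ 1 - 1)) := by
      have h2 : φ 1 - 1 = (1 / 2 : ℂ) • ((φ 1 - 1) + (φ 1 - 1)) := by
        rw [← two_smul ℂ, smul_smul]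
        norm_num
      rw [add_apply, add_sub_right_comm, h2, hχ, ← smul_add]
      simp only [star_sub, star_add, ← hstar, star_one]
      congr 1
      abel
    rw [h1]
    refine (hhalf _ _ _ hψ1 (by rwa [norm_star])).trans ?_
    refine mul_le_mul_of_nonneg_right ?_ (sq_nonneg ε)
    nlinarith [sq_nonneg (K * N)]

/-- Stability of finite-dimensional C*-algebras: an approximately multiplicative, `*`-preserving
linear map of bounded norm into a closed `*`-subalgebra is close to a `*`-homomorphism. -/
theorem exists_starAlgHom_near [FiniteDimensional ℂ F] (P : StarSubalgebra ℂ A)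
    (hPc : IsClosed (P : Set A)) (K : ℝ) :
    ∃ L ε₀ : ℝ, 0 ≤ L ∧ 0 < ε₀ ∧ ∀ (ε : ℝ) (φ : F →L[ℂ] A), 0 ≤ ε → ε ≤ ε₀ → IsApproxHom φ ε →
      ‖φ‖ ≤ K → (∀ a, φ a ∈ P) → (∀ a, φ (star a) = star (φ a)) →
      ∃ π : F →⋆ₐ[ℂ] A, (∀ a, π a ∈ P) ∧ ∀ a, ‖φ a - π a‖ ≤ L * ε * ‖a‖ := by
  have : IsSemisimpleRing F := isSemisimpleRing_of_star_mul_self_injective F fun x h =>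
    (CStarRing.star_mul_self_eq_zero_iff x).1 h
  obtain ⟨ι, _, x, y, c, hxy, hx, hy⟩ := IsSemisimpleRing.exists_separability_system F
  rcases lt_or_ge K 0 with hK0 | hK0
  · exact ⟨0, 1, le_rfl, one_pos, fun ε φ _ _ _ h => absurd (norm_nonneg φ) (by linarith)⟩
  set N := ∑ i, ‖x i‖ * ‖y i‖ with hN
  have hN0 : 0 ≤ N := Finset.sum_nonneg fun i _ => by positivity
  set C := 1 + 2 * N + ((K + 1) * N) ^ 2 with hC
  have hC0 : 0 < C := by positivity
  set L := (K + 1) * N with hL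
  have hL0 : 0 ≤ L := by positivity
  refine ⟨2 * L, min (1 / (2 * C)) (1 / (2 * L + 1)), by positivity, by positivity, ?_⟩
  intro ε φ hε hε0 hφ hK hP hstar
  have hεC : C * ε ≤ 1 / 2 := by
    have := hε0.trans (min_le_left _ _)
    rw [le_div_iff₀ (by positivity)] at this
    linarith
  have hεL : 2 * L * ε ≤ 1 := by
    have := hε0.trans (min_le_right _ _)
    rw [le_div_iff₀ (by positivity)] at this
    nlinarith
  let S : ℕ → Set (F →L[ℂ] A) := fun k => {ψ | (∀ a, ψ a ∈ P) ∧ (∀ a, ψ (star a) = star (ψ a)) ∧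
    IsApproxHom ψ (ε / 2 ^ k) ∧ ‖ψ - φ‖ ≤ 2 * L * ε * (1 - 1 / 2 ^ k)}
  have hstep : ∀ k ψ, ψ ∈ S k → ∃ ψ' ∈ S (k + 1), ‖ψ' - ψ‖ ≤ L * (ε / 2 ^ k) := by
    rintro k ψ ⟨h1, h2, h3, h4⟩
    have hψK : ‖ψ‖ ≤ K + 1 := by
      have h5 : ‖ψ‖ ≤ ‖φ‖ + ‖ψ - φ‖ := norm_le_norm_add_norm_sub' _ _
      have h6 : 2 * L * ε * (1 - 1 / 2 ^ k) ≤ 2 * L * ε * 1 := by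
        gcongr
        simp
      linarith
    have hk0 : 0 ≤ ε / 2 ^ k := by positivity
    obtain ⟨ψ', g1, g2, g3, g4⟩ := h3.exists_improvement hxy hx hy P hk0 hψK h1 h2
    have hkε : ε / 2 ^ k ≤ ε := div_le_self hε (one_le_pow₀ one_le_two)
    have hle : C * (ε / 2 ^ k) ^ 2 ≤ ε / 2 ^ (k + 1) := by
      calc C * (ε / 2 ^ k) ^ 2 = C * (ε / 2 ^ k) * (ε / 2 ^ k) := by ring
        _ ≤ (C * ε) * (ε / 2 ^ k) := by gcongr
        _ ≤ 1 / 2 * (ε / 2 ^ k) := by gcongr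
        _ = _ := by rw [pow_succ]; field_simp
    refine ⟨ψ', ⟨g1, g2, ⟨fun a b => (g4.1 a b).trans ?_, g4.2.trans hle⟩, ?_⟩, g3⟩
    · gcongr
    · calc ‖ψ' - φ‖ ≤ ‖ψ' - ψ‖ + ‖ψ - φ‖ := norm_sub_le_norm_sub_add_norm_sub _ _ _
        _ ≤ L * (ε / 2 ^ k) + 2 * L * ε * (1 - 1 / 2 ^ k) := add_le_add g3 h4
        _ = _ := by rw [pow_succ]; field_simp; ring
  choose! next hnext hdist using hstep
  let u : ℕ → F →L[ℂ] A := fun k => Nat.rec φ next k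
  have hu : ∀ k, u k ∈ S k := fun k => by
    induction k with
    | zero => exact ⟨hP, hstar, by simpa [u] using hφ, by simp [u]⟩
    | succ k ih => exact hnext k _ ih
  have hud : ∀ k, dist (u k) (u (k + 1)) ≤ 2 * (L * ε) / 2 / 2 ^ k := fun k => by
    rw [dist_comm, dist_eq_norm]
    exact (hdist k _ (hu k)).trans_eq (by ring)
  obtain ⟨π, hπ⟩ := cauchySeq_tendsto_of_complete (cauchySeq_of_le_geometric_two hud)
  have hπa : ∀ a, Tendsto (fun k => u k a) atTop (𝓝 (π a)) := fun a =>
    ((ContinuousLinearMap.apply ℂ A a).continuous.tendsto π).comp hπ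
  have hlim : ∀ t : ℝ, Tendsto (fun k : ℕ => ε / 2 ^ k * t) atTop (𝓝 0) := fun t => by
    have h1 := (tendsto_pow_atTop_nhds_zero_of_lt_one (r := (1 / 2 : ℝ)) (by norm_num)
      (by norm_num)).const_mul (ε * t)
    rw [mul_zero] at h1
    refine h1.congr fun k => ?_
    rw [one_div, inv_pow]
    ring
  have hπmul : ∀ a b, π (a * b) = π a * π b := fun a b => by
    have h1 : Tendsto (fun k => u k (a * b) - u k a * u k b) atTop (𝓝 0) :=
      squeeze_zero_norm (fun k => ((hu k).2.2.1.1 a b).trans_eq (mul_assoc _ _ _)) (hlim _)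
    exact sub_eq_zero.1 (tendsto_nhds_unique ((hπa _).sub ((hπa a).mul (hπa b))) h1)
  have hπone : π 1 = 1 := by
    have h1 : Tendsto (fun k => u k 1 - 1) atTop (𝓝 0) :=
      squeeze_zero_norm (fun k => (hu k).2.2.1.2.trans_eq (mul_one _).symm) (hlim 1)
    exact sub_eq_zero.1 (tendsto_nhds_unique ((hπa 1).sub_const 1) h1)
  have hπstar : ∀ a, π (star a) = star (π a) := fun a =>
    tendsto_nhds_unique ((hπa (star a)).congr fun k => (hu k).2.1 a) (hπa a).star
  refine ⟨{ AlgHom.ofLinearMap (π : F →ₗ[ℂ] A) hπone hπmul with map_star' := hπstar },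
    fun a => hPc.mem_of_tendsto (hπa a) (Eventually.of_forall fun k => (hu k).1 a), fun a => ?_⟩
  have h1 := dist_le_of_le_geometric_two_of_tendsto₀ hud hπ
  rw [dist_eq_norm] at h1
  exact (((u 0 - π).le_opNorm a).trans (mul_le_mul_of_nonneg_right h1 (norm_nonneg a))).trans_eq
    (by ring)

end Stability

section CondExp

variable {A : Type*} [CStarAlgebra A] [PartialOrder A] [StarOrderedRing A]
  {P : StarSubalgebra ℂ A} {E : A → A}

namespace IsCondExp

theorem map_neg (hE : IsCondExp P E) (x : A) : E (-x) = -E x := by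
  simpa using hE.map_smul (-1) x

theorem map_sub (hE : IsCondExp P E) (x y : A) : E (x - y) = E x - E y := by
  rw [sub_eq_add_neg, hE.map_add, hE.map_neg, ← sub_eq_add_neg]

theorem map_sum (hE : IsCondExp P E) {ι : Type*} (s : Finset ι) (f : ι → A) :
    E (∑ i ∈ s, f i) = ∑ i ∈ s, E (f i) :=
  _root_.map_sum (AddMonoidHom.mk' E hE.map_add) f s

theorem map_mul_left (hE : IsCondExp P E) {p : A} (hp : p ∈ P) (x : A) : E (p * x) = p * E x := by
  simpa using hE.bimod p hp 1 (one_mem P) x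

theorem map_mul_right (hE : IsCondExp P E) {p : A} (hp : p ∈ P) (x : A) : E (x * p) = E x * p := by
  simpa using hE.bimod 1 (one_mem P) p hp x

theorem norm_le (hE : IsCondExp P E) (x : A) : ‖E x‖ ≤ ‖x‖ := by
  have hschwarz : star (E x) * E x ≤ E (star x * x) := by
    have h := hE.pos (x - E x)
    have hx := hE.mem x
    rw [star_sub, sub_mul, mul_sub, mul_sub, hE.map_sub, hE.map_sub, hE.map_sub,
      hE.map_mul_right hx, hE.map_mul_left (star_mem hx), hE.map_mul_left (star_mem hx),
      hE.star_map, hE.fix _ hx, sub_self, sub_zero] at h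
    exact sub_nonneg.1 h
  have hmono : E (star x * x) ≤ algebraMap ℝ A (‖x‖ ^ 2) := by
    have h0 : 0 ≤ algebraMap ℝ A (‖x‖ ^ 2) - star x * x :=
      sub_nonneg.2 CStarAlgebra.star_mul_le_algebraMap_norm_sq
    obtain ⟨y, hy⟩ := CStarAlgebra.nonneg_iff_eq_star_mul_self.1 h0
    have h1 := hE.pos y
    have hfix : E (algebraMap ℝ A (‖x‖ ^ 2)) = algebraMap ℝ A (‖x‖ ^ 2) := by
      refine hE.fix _ ?_
      rw [IsScalarTower.algebraMap_apply ℝ ℂ A]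
      exact algebraMap_mem P _
    rw [← hy, hE.map_sub, hfix] at h1
    exact sub_nonneg.1 h1
  have h := CStarAlgebra.norm_le_norm_of_nonneg_of_le (star_mul_self_nonneg (E x))
    (hschwarz.trans hmono)
  rw [CStarRing.norm_star_mul_self] at h
  rcases subsingleton_or_nontrivial A with _ | _
  · simp [Subsingleton.elim (E x) 0]
  · rw [norm_algebraMap', Real.norm_of_nonneg (sq_nonneg _)] at h
    nlinarith [norm_nonneg (E x), norm_nonneg x]

theorem isClosed (hE : IsCondExp P E) : IsClosed (P : Set A) := by
  have hc : Continuous E := by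
    refine (LipschitzWith.of_dist_le_mul (K := 1) fun x y => ?_).continuous
    rw [dist_eq_norm, dist_eq_norm, ← hE.map_sub, NNReal.coe_one, one_mul]
    exact hE.norm_le _
  have : (P : Set A) = {x | E x = x} :=
    Set.ext fun x => ⟨hE.fix x, fun h => by rw [← show E x = x from h]; exact hE.mem x⟩
  rw [this]
  exact isClosed_eq hc continuous_id

/-- A quasi-basis may be replaced by one of the form `{(w i, star (w i))}` without changing the
index. -/
theorem exists_star_quasiBasis (hE : IsCondExp P E) {n : ℕ} {u v : Fin n → A}
    (huv : IsQuasiBasis E u v) :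
    ∃ w : Fin n → A, IsQuasiBasis E w (fun i => star (w i)) ∧
      ∑ i, w i * star (w i) = ∑ i, u i * v i := by
  have := hE.isClosed
  let H : Fin n → Fin n → P := fun i j => ⟨E (star (u i) * u j), hE.mem _⟩
  obtain ⟨R, hR⟩ := CStarAlgebra.exists_matrix_eq_star_mul_self H
    (fun i j => Subtype.ext (by
      change star (E (star (u i) * u j)) = E (star (u j) * u i)
      rw [← hE.star_map, star_mul, star_star]))
    (by
      intro p g hpg
      have h1 : E (star (∑ j, u j * p j) * ∑ j, u j * p j) = -∑ l, star (g l : A) * g l := by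
        have h2 := congrArg (Subtype.val) hpg
        push_cast at h2
        refine Eq.trans ?_ h2
        rw [star_sum, Finset.sum_mul, hE.map_sum]
        refine Finset.sum_congr rfl fun i _ => ?_
        rw [Finset.mul_sum, hE.map_sum]
        refine Finset.sum_congr rfl fun j _ => ?_
        rw [star_mul, mul_assoc, ← mul_assoc (star (u i)), ← mul_assoc,
          hE.bimod _ (star_mem (p i).2) _ (p j).2]
        rfl
      have h3 := hE.pos (∑ j, u j * (p j : A))
      rw [h1, neg_nonneg] at h3
      have h4 := (Finset.sum_eq_zero_iff_of_nonneg fun l _ => star_mul_self_nonneg (g l : A)).1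
        (h3.antisymm (Finset.sum_nonneg fun l _ => star_mul_self_nonneg (g l : A)))
      intro l
      exact Subtype.ext ((CStarRing.star_mul_self_eq_zero_iff _).1 (h4 l (Finset.mem_univ l))))
  have hRA : ∀ i j, E (star (u i) * u j) = ∑ k, star (R k i : A) * R k j := fun i j => by
    have h := congrArg Subtype.val (hR i j)
    push_cast at h
    exact h
  have hv : ∀ j, ∑ i, star (v i) * E (star (u i) * u j) = u j := fun j => by
    have h := congrArg star (huv (star (u j))).2
    rw [star_star, star_sum] at h
    refine Eq.trans ?_ h.symm
    refine Finset.sum_congr rfl fun i _ => ?_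
    rw [star_mul, ← hE.star_map, star_mul, star_star]
  let w : Fin n → A := fun k => ∑ i, star (v i) * star (R k i : A)
  have hw : ∀ k, star (w k) = ∑ i, (R k i : A) * v i := fun k => by
    simp only [w, star_sum, star_mul, star_star]
  have hleft : ∀ a, ∑ k, w k * E (star (w k) * a) = a := fun a => by
    have h1 : ∀ k, E (star (w k) * a) = ∑ j, (R k j : A) * E (v j * a) := fun k => by
      rw [hw, Finset.sum_mul, hE.map_sum]
      exact Finset.sum_congr rfl fun j _ => by rw [mul_assoc, hE.map_mul_left (R k j).2]
    calc ∑ k, w k * E (star (w k) * a)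
        = ∑ k, ∑ j, ∑ i, star (v i) * (star (R k i : A) * R k j) * E (v j * a) := by
          refine Finset.sum_congr rfl fun k _ => ?_
          rw [h1, Finset.mul_sum]
          refine Finset.sum_congr rfl fun j _ => ?_
          rw [Finset.sum_mul]
          exact Finset.sum_congr rfl fun i _ => by noncomm_ring
      _ = ∑ j, ∑ i, star (v i) * E (star (u i) * u j) * E (v j * a) := by
          rw [Finset.sum_comm]
          refine Finset.sum_congr rfl fun j _ => ?_
          rw [Finset.sum_comm]
          refine Finset.sum_congr rfl fun i _ => ?_
          rw [hRA, Finset.mul_sum, Finset.sum_mul]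
      _ = ∑ j, u j * E (v j * a) := by
          refine Finset.sum_congr rfl fun j _ => ?_
          rw [← Finset.sum_mul, hv]
      _ = a := ((huv a).1).symm
  refine ⟨w, fun a => ⟨(hleft a).symm, ?_⟩, ?_⟩
  · have h := congrArg star (hleft (star a))
    rw [star_star, star_sum] at h
    conv_lhs => rw [← h]
    refine Finset.sum_congr rfl fun k _ => ?_
    rw [star_mul, ← hE.star_map, star_mul, star_star, star_star]
  · calc ∑ k, w k * star (w k)
        = ∑ k, ∑ j, ∑ i, star (v i) * (star (R k i : A) * R k j) * v j := by
          refine Finset.sum_congr rfl fun k _ => ?_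
          rw [hw, Finset.mul_sum]
          refine Finset.sum_congr rfl fun j _ => ?_
          rw [Finset.sum_mul]
          exact Finset.sum_congr rfl fun i _ => by noncomm_ring
      _ = ∑ j, ∑ i, star (v i) * E (star (u i) * u j) * v j := by
          rw [Finset.sum_comm]
          refine Finset.sum_congr rfl fun j _ => ?_
          rw [Finset.sum_comm]
          refine Finset.sum_congr rfl fun i _ => ?_
          rw [hRA, Finset.mul_sum, Finset.sum_mul]
      _ = ∑ j, u j * v j := by
          refine Finset.sum_congr rfl fun j _ => ?_
          rw [← Finset.sum_mul, hv]

end IsCondExp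

end CondExp

/-- In a `*`-ring with a conditional expectation `E`, a star quasi-basis `w` and index `I`, a
projection `e` with `E e = I⁻¹` satisfies `e z = I e E(e z)`. -/
theorem proj_mul_eq_of_starQuasiBasis {R : Type*} [Ring R] [StarRing R] {E : R → R} {n : ℕ}
    {w : Fin n → R} {e I J : R} (hadd : ∀ x y, E (x + y) = E x + E y)
    (hright : ∀ x y, E (x * E y) = E x * E y)
    (hstar : ∀ x, E (star x) = star (E x))
    (hw : IsQuasiBasis E w fun i => star (w i)) (hI : ∑ i, w i * star (w i) = I)
    (hIc : ∀ x, Commute I x) (hIstar : star I = I) (hIJ : I * J = 1)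
    (he : e * e = e) (hestar : star e = e) (heE : E e = J)
    (hfaithful : ∀ t : Fin n → R, ∑ i, t i * star (t i) = 0 → ∀ i, t i = 0) (z : R) :
    e * z = I * e * E (e * z) := by
  have hsum : ∀ f : Fin n → R, E (∑ i, f i) = ∑ i, E (f i) := fun f =>
    map_sum (AddMonoidHom.mk' E hadd) f _
  have ht := hfaithful (fun i => e * w i - I * e * E (e * w i)) (by
    have h1 : ∑ i, w i * E (star (w i) * e) = e := ((hw e).1).symm
    have h2 : ∑ i, E (e * w i) * star (w i) = e := ((hw e).2).symm
    have h3 : ∑ i, E (e * w i) * E (star (w i) * e) = J := by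
      simp only [← hright, ← hsum, mul_assoc, ← Finset.mul_sum]
      rw [h1, he, heE]
    have hexp : ∀ i, (e * w i - I * e * E (e * w i)) * star (e * w i - I * e * E (e * w i)) =
        e * (w i * star (w i)) * e - e * (w i * E (star (w i) * e)) * (e * I)
          - I * e * (E (e * w i) * star (w i)) * e
          + I * e * (E (e * w i) * E (star (w i) * e)) * (e * I) := fun i => by
      rw [star_sub, star_mul, star_mul, star_mul, ← hstar, star_mul, hestar, hIstar]
      noncomm_ring
    simp only [hexp, Finset.sum_add_distrib, Finset.sum_sub_distrib, ← Finset.sum_mul,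
      ← Finset.mul_sum, h1, h2, h3, hI]
    have hJ : I * e * J * (e * I) = I * e := by
      rw [(hIc e).eq, mul_assoc e I J, hIJ, mul_one, ← mul_assoc, he]
    rw [hJ, he, mul_assoc I e e, he, mul_assoc I e e, he, ← mul_assoc, he, ← (hIc e).eq,
      mul_assoc, he]
    abel)
  have hz : z = ∑ i, w i * E (star (w i) * z) := (hw z).1
  have h4 : ∀ i, e * w i = I * e * E (e * w i) := fun i => sub_eq_zero.1 (ht i)
  have h5 : e * z = ∑ i, e * w i * E (star (w i) * z) := by
    conv_lhs => rw [hz]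
    simp only [Finset.mul_sum, mul_assoc]
  conv_rhs => rw [h5, hsum]
  simp only [hright]
  rw [Finset.mul_sum, h5]
  exact Finset.sum_congr rfl fun i _ => by rw [← mul_assoc, ← h4]

namespace IsBddSeq

variable {A : Type*} [CStarAlgebra A] {a b : ℕ → A}

theorem const (x : A) : IsBddSeq fun _ : ℕ => x := ⟨‖x‖, fun _ => le_rfl⟩

theorem add (ha : IsBddSeq a) (hb : IsBddSeq b) : IsBddSeq (a + b) := by
  obtain ⟨C, hC⟩ := ha
  obtain ⟨D, hD⟩ := hb
  exact ⟨C + D, fun n => (norm_add_le _ _).trans (add_le_add (hC n) (hD n))⟩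

theorem mul (ha : IsBddSeq a) (hb : IsBddSeq b) : IsBddSeq (a * b) := by
  obtain ⟨C, hC⟩ := ha
  obtain ⟨D, hD⟩ := hb
  exact ⟨C * D, fun n => (norm_mul_le _ _).trans
    (mul_le_mul (hC n) (hD n) (norm_nonneg _) ((norm_nonneg _).trans (hC n)))⟩

theorem smul (c : ℂ) (ha : IsBddSeq a) : IsBddSeq (c • a) := by
  obtain ⟨C, hC⟩ := ha
  exact ⟨‖c‖ * C, fun n => (norm_smul_le c (a n)).trans
    (mul_le_mul_of_nonneg_left (hC n) (norm_nonneg _))⟩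

theorem sub (ha : IsBddSeq a) (hb : IsBddSeq b) : IsBddSeq (a - b) := by
  obtain ⟨C, hC⟩ := ha
  obtain ⟨D, hD⟩ := hb
  exact ⟨C + D, fun n => (norm_sub_le _ _).trans (add_le_add (hC n) (hD n))⟩

theorem star (ha : IsBddSeq a) : IsBddSeq (star a) := by
  obtain ⟨C, hC⟩ := ha
  exact ⟨C, fun n => (norm_star (a n)).trans_le (hC n)⟩

theorem sum {ι : Type*} (s : Finset ι) {f : ι → ℕ → A} (hf : ∀ i, IsBddSeq (f i)) :
    IsBddSeq (∑ i ∈ s, f i) := by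
  choose C hC using hf
  refine ⟨∑ i ∈ s, C i, fun n => ?_⟩
  rw [Finset.sum_apply]
  exact norm_sum_le_of_le s fun i _ => hC i n

end IsBddSeq

namespace SeqAlg

variable {A : Type*} [CStarAlgebra A] {Ainf : Type*} [Ring Ainf] [StarRing Ainf] [Algebra ℂ Ainf]

theorem q_sub (S : SeqAlg A Ainf) {a b : ℕ → A} (ha : IsBddSeq a) (hb : IsBddSeq b) :
    S.q (a - b) = S.q a - S.q b := by
  rw [eq_sub_iff_add_eq, ← S.q_add _ _ (ha.sub hb) hb, sub_add_cancel]

theorem q_sum (S : SeqAlg A Ainf) {ι : Type*} (s : Finset ι) {f : ι → ℕ → A}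
    (hf : ∀ i, IsBddSeq (f i)) :
    S.q (∑ i ∈ s, f i) = ∑ i ∈ s, S.q (f i) := by
  classical
  induction s using Finset.induction_on with
  | empty => simpa using S.q_smul 0 0 (IsBddSeq.const 0)
  | insert i s hi ih =>
    rw [Finset.sum_insert hi, Finset.sum_insert hi, S.q_add _ _ (hf i) (IsBddSeq.sum s hf), ih]

theorem q_eq_q_iff (S : SeqAlg A Ainf) {a b : ℕ → A} (ha : IsBddSeq a) (hb : IsBddSeq b) :
    S.q a = S.q b ↔ Tendsto (fun n => ‖a n - b n‖) atTop (𝓝 0) := by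
  rw [← sub_eq_zero, ← S.q_sub ha hb]
  exact S.q_eq_zero_iff _ (ha.sub hb)

theorem incl_one (S : SeqAlg A Ainf) : S.incl 1 = 1 := S.q_one

theorem incl_mul (S : SeqAlg A Ainf) (x y : A) : S.incl (x * y) = S.incl x * S.incl y :=
  S.q_mul _ _ (.const x) (.const y)

theorem incl_star (S : SeqAlg A Ainf) (x : A) : S.incl (star x) = star (S.incl x) :=
  S.q_star _ (.const x)

theorem incl_sum (S : SeqAlg A Ainf) {ι : Type*} (s : Finset ι) (f : ι → A) :
    S.incl (∑ i ∈ s, f i) = ∑ i ∈ s, S.incl (f i) := by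
  rw [incl, show (fun _ : ℕ => ∑ i ∈ s, f i) = ∑ i ∈ s, fun _ => f i from
    funext fun n => by rw [Finset.sum_apply]]
  exact S.q_sum s fun i => .const (f i)

theorem eq_zero_of_sum_mul_star_eq_zero (S : SeqAlg A Ainf) [PartialOrder A]
    [StarOrderedRing A] {m : ℕ} {t : Fin m → Ainf} (ht : ∑ i, t i * star (t i) = 0)
    (i : Fin m) : t i = 0 := by
  choose a ha hat using fun i => S.surj (t i)
  have hb : ∀ i, IsBddSeq (a i * star (a i)) := fun i => (ha i).mul (ha i).star
  have h0 : S.q (∑ i, a i * star (a i)) = 0 := by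
    rw [S.q_sum _ hb, ← ht]
    exact Finset.sum_congr rfl fun i _ => by
      rw [S.q_mul _ _ (ha i) (ha i).star, S.q_star _ (ha i), hat]
  have h1 := (S.q_eq_zero_iff _ (IsBddSeq.sum _ hb)).1 h0
  rw [← hat, S.q_eq_zero_iff _ (ha i)]
  have h2 : Tendsto (fun n => ‖a i n‖ ^ 2) atTop (𝓝 0) := by
    refine squeeze_zero (fun n => sq_nonneg _) (fun n => ?_) h1
    rw [sq, ← CStarRing.norm_self_mul_star]
    refine CStarAlgebra.norm_le_norm_of_nonneg_of_le (mul_star_self_nonneg _) ?_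
    rw [Finset.sum_apply]
    exact Finset.single_le_sum (f := fun j => (a j * star (a j)) n)
      (fun j _ => mul_star_self_nonneg (a j n)) (Finset.mem_univ i)
  simpa [Real.sqrt_sq (norm_nonneg _)] using h2.sqrt

end SeqAlg

namespace RohlinInclusion

variable {A : Type*} [CStarAlgebra A] [PartialOrder A] [StarOrderedRing A]
  {P : StarSubalgebra ℂ A} {E : A → A} {Ainf : Type*} [Ring Ainf] [StarRing Ainf]
  [Algebra ℂ Ainf] {S : SeqAlg A Ainf} {Einf : Ainf → Ainf}

theorem _root_.IsBddSeq.condExp {a : ℕ → A} (hE : IsCondExp P E) (ha : IsBddSeq a) :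
    IsBddSeq fun n => E (a n) := by
  obtain ⟨C, hC⟩ := ha
  exact ⟨C, fun n => (hE.norm_le _).trans (hC n)⟩

theorem Einf_add (hR : RohlinInclusion P E S Einf) (x y : Ainf) :
    Einf (x + y) = Einf x + Einf y := by
  obtain ⟨a, ha, rfl⟩ := S.surj x
  obtain ⟨b, hb, rfl⟩ := S.surj y
  rw [← S.q_add _ _ ha hb, hR.Einf_compat _ (ha.add hb), hR.Einf_compat _ ha, hR.Einf_compat _ hb,
    ← S.q_add _ _ (ha.condExp hR.condExp) (hb.condExp hR.condExp)]
  exact congrArg S.q (funext fun n => hR.condExp.map_add _ _)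

theorem Einf_mul_Einf (hR : RohlinInclusion P E S Einf) (x y : Ainf) :
    Einf (x * Einf y) = Einf x * Einf y := by
  obtain ⟨a, ha, rfl⟩ := S.surj x
  obtain ⟨b, hb, rfl⟩ := S.surj y
  have hEb := hb.condExp hR.condExp
  rw [hR.Einf_compat _ hb, ← S.q_mul _ _ ha hEb, hR.Einf_compat _ (ha.mul hEb),
    hR.Einf_compat _ ha, ← S.q_mul _ _ (ha.condExp hR.condExp) hEb]
  exact congrArg S.q (funext fun n => hR.condExp.map_mul_right (hR.condExp.mem _) _)

theorem Einf_star (hR : RohlinInclusion P E S Einf) (x : Ainf) : Einf (star x) = star (Einf x) := by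
  obtain ⟨a, ha, rfl⟩ := S.surj x
  rw [← S.q_star _ ha, hR.Einf_compat _ ha.star, hR.Einf_compat _ ha,
    ← S.q_star _ (ha.condExp hR.condExp)]
  exact congrArg S.q (funext fun n => hR.condExp.star_map _)

theorem Einf_incl (hR : RohlinInclusion P E S Einf) {p : A} (hp : p ∈ P) :
    Einf (S.incl p) = S.incl p := by
  rw [SeqAlg.incl, hR.Einf_compat _ (.const p), hR.condExp.fix p hp]

theorem Einf_sum (hR : RohlinInclusion P E S Einf) {ι : Type*} (s : Finset ι) (f : ι → Ainf) :
    Einf (∑ i ∈ s, f i) = ∑ i ∈ s, Einf (f i) :=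
  map_sum (AddMonoidHom.mk' Einf hR.Einf_add) f s

theorem isQuasiBasis_incl (hR : RohlinInclusion P E S Einf) {n : ℕ} {w : Fin n → A}
    (hw : IsQuasiBasis E w fun i => star (w i)) :
    IsQuasiBasis Einf (fun i => S.incl (w i)) fun i => star (S.incl (w i)) := fun z => by
  obtain ⟨a, ha, rfl⟩ := S.surj z
  have hc : ∀ x, IsBddSeq fun _ : ℕ => (x : A) := IsBddSeq.const
  have hl : ∀ i, IsBddSeq fun n => star (w i) * a n := fun i => (hc _).mul ha
  have hr : ∀ i, IsBddSeq fun n => a n * w i := fun i => ha.mul (hc _)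
  constructor
  · have h : ∀ i, S.incl (w i) * Einf (star (S.incl (w i)) * S.q a) =
        S.q ((fun _ => w i) * fun n => E (star (w i) * a n)) := fun i => by
      rw [← S.incl_star, S.q_mul _ _ (hc _) ((hl i).condExp hR.condExp), ← hR.Einf_compat _ (hl i),
        SeqAlg.incl, SeqAlg.incl, ← S.q_mul _ _ (hc _) ha]
      rfl
    simp only [h]
    rw [← S.q_sum _ fun i => (hc _).mul ((hl i).condExp hR.condExp)]
    refine congrArg S.q (funext fun n => ?_)
    rw [Finset.sum_apply]
    exact (hw (a n)).1
  · have h : ∀ i, Einf (S.q a * S.incl (w i)) * star (S.incl (w i)) =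
        S.q ((fun n => E (a n * w i)) * fun _ => star (w i)) := fun i => by
      rw [← S.incl_star, S.q_mul _ _ ((hr i).condExp hR.condExp) (hc _), ← hR.Einf_compat _ (hr i),
        SeqAlg.incl, SeqAlg.incl, ← S.q_mul _ _ ha (hc _)]
      rfl
    simp only [h]
    rw [← S.q_sum _ fun i => ((hr i).condExp hR.condExp).mul (hc _)]
    refine congrArg S.q (funext fun n => ?_)
    rw [Finset.sum_apply]
    exact (hw (a n)).2

theorem commute_incl_ind (hR : RohlinInclusion P E S Einf) (z : Ainf) :
    Commute (S.incl hR.ind) z := by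
  obtain ⟨a, ha, rfl⟩ := S.surj z
  rw [SeqAlg.incl, Commute, SemiconjBy, ← S.q_mul _ _ (.const _) ha, ← S.q_mul _ _ ha (.const _)]
  exact congrArg S.q (funext fun n => hR.ind_central _)

theorem star_incl_ind (hR : RohlinInclusion P E S Einf) : star (S.incl hR.ind) = S.incl hR.ind := by
  rw [← S.incl_star, (IsSelfAdjoint.of_nonneg hR.ind_pos).star_eq]

theorem incl_ind_mul_indInv (hR : RohlinInclusion P E S Einf) :
    S.incl hR.ind * S.incl hR.indInv = 1 := by
  rw [← S.incl_mul, hR.ind_mul_inv, S.incl_one]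

theorem e_mul_eq (hR : RohlinInclusion P E S Einf) (z : Ainf) :
    hR.e * z = S.incl hR.ind * hR.e * Einf (hR.e * z) := by
  obtain ⟨n, u, v, huv, hind⟩ := hR.quasiBasis
  obtain ⟨w, hw, hwind⟩ := hR.condExp.exists_star_quasiBasis huv
  refine proj_mul_eq_of_starQuasiBasis hR.Einf_add hR.Einf_mul_Einf hR.Einf_star
    (hR.isQuasiBasis_incl hw) ?_ hR.commute_incl_ind hR.star_incl_ind hR.incl_ind_mul_indInv
    hR.e_idem hR.e_star hR.e_exp (fun _ => S.eq_zero_of_sum_mul_star_eq_zero) z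
  rw [← hind, ← hwind, S.incl_sum]
  exact Finset.sum_congr rfl fun i _ => by rw [S.incl_mul, S.incl_star]

/-- The compression `x ↦ (Index E) E^∞(e x)` of `A` into `P^∞` is multiplicative. -/
theorem compression_mul (hR : RohlinInclusion P E S Einf) (x y : A) :
    S.incl hR.ind * Einf (hR.e * S.incl (x * y)) =
      S.incl hR.ind * Einf (hR.e * S.incl x) * (S.incl hR.ind * Einf (hR.e * S.incl y)) := by
  have hI := hR.Einf_incl hR.ind_mem
  have h : hR.e * S.incl (x * y) =
      S.incl hR.ind * (hR.e * S.incl x * Einf (hR.e * S.incl y)) := by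
    rw [S.incl_mul, ← mul_assoc, (hR.e_comm x).eq, mul_assoc]
    conv_lhs => rw [hR.e_mul_eq (S.incl y)]
    rw [mul_assoc (S.incl hR.ind), ← mul_assoc, ← (hR.commute_incl_ind (S.incl x)).eq]
    simp only [mul_assoc]
  have h2 : Einf (S.incl hR.ind * (hR.e * S.incl x * Einf (hR.e * S.incl y))) =
      S.incl hR.ind * (Einf (hR.e * S.incl x) * Einf (hR.e * S.incl y)) := by
    rw [(hR.commute_incl_ind _).eq, ← hI, hR.Einf_mul_Einf, hR.Einf_mul_Einf, hI,
      ← (hR.commute_incl_ind _).eq]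
  rw [h, h2, mul_assoc (S.incl hR.ind) (Einf _) (_ * _), ← mul_assoc (Einf _) (S.incl hR.ind),
    ← (hR.commute_incl_ind (Einf _)).eq]
  simp only [mul_assoc]

theorem compression_of_mem (hR : RohlinInclusion P E S Einf) {p : A} (hp : p ∈ P) :
    S.incl hR.ind * Einf (hR.e * S.incl p) = S.incl p := by
  rw [← hR.Einf_incl hp, hR.Einf_mul_Einf, hR.e_exp, ← mul_assoc, hR.incl_ind_mul_indInv, one_mul]

theorem compression_symm (hR : RohlinInclusion P E S Einf) (x : A) :
    Einf (S.incl x * star hR.e) = Einf (hR.e * S.incl x) := by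
  rw [hR.e_star, (hR.e_comm x).eq]

end RohlinInclusion

/-- A Rohlin inclusion admits an asymptotically multiplicative sequence of `*`-preserving
bounded linear maps `A → P` that converges pointwise to the identity on `P`. -/
theorem RohlinInclusion.exists_asymptotic_hom {A : Type*} [CStarAlgebra A] [PartialOrder A]
    [StarOrderedRing A] {P : StarSubalgebra ℂ A} {E : A → A} {Ainf : Type*} [Ring Ainf]
    [StarRing Ainf] [Algebra ℂ Ainf] {S : SeqAlg A Ainf} {Einf : Ainf → Ainf}
    (hR : RohlinInclusion P E S Einf) :
    ∃ (φ : ℕ → A →L[ℂ] A) (K : ℝ), (∀ n, ‖φ n‖ ≤ K) ∧ (∀ n a, φ n a ∈ P) ∧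
      (∀ n a, φ n (star a) = star (φ n a)) ∧
      (∀ a b, Tendsto (fun n => ‖φ n (a * b) - φ n a * φ n b‖) atTop (𝓝 0)) ∧
      ∀ p ∈ P, Tendsto (fun n => ‖φ n p - p‖) atTop (𝓝 0) := by
  have hE := hR.condExp
  obtain ⟨e, he, hqe⟩ := S.surj hR.e
  obtain ⟨C, hC⟩ := id he
  let f : ℕ → A →ₗ[ℂ] A := fun n =>
    { toFun := fun a => (1 / 2 : ℂ) • (hR.ind * (E (e n * a) + E (a * star (e n))))
      map_add' := fun a b => by
        rw [mul_add (e n), add_mul, hE.map_add, hE.map_add, ← smul_add, ← mul_add]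
        congr 2
        abel
      map_smul' := fun c a => by
        rw [mul_smul_comm, smul_mul_assoc, hE.map_smul, hE.map_smul, ← smul_add, mul_smul_comm,
          smul_comm, RingHom.id_apply] }
  have hf : ∀ n a, f n a = (1 / 2 : ℂ) • (hR.ind * (E (e n * a) + E (a * star (e n)))) :=
    fun _ _ => rfl
  have hbound : ∀ n a, ‖f n a‖ ≤ ‖hR.ind‖ * C * ‖a‖ := fun n a => by
    have h1 : ‖E (e n * a)‖ ≤ C * ‖a‖ := (hE.norm_le _).trans
      ((norm_mul_le _ _).trans (mul_le_mul_of_nonneg_right (hC n) (norm_nonneg a)))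
    have h2 : ‖E (a * star (e n))‖ ≤ C * ‖a‖ := by
      refine (hE.norm_le _).trans ((norm_mul_le _ _).trans ?_)
      rw [norm_star, mul_comm]
      exact mul_le_mul_of_nonneg_right (hC n) (norm_nonneg a)
    have h3 := (norm_mul_le hR.ind _).trans (mul_le_mul_of_nonneg_left
      ((norm_add_le _ _).trans (add_le_add h1 h2)) (norm_nonneg hR.ind))
    rw [hf, norm_smul, show ‖(1 / 2 : ℂ)‖ = 1 / 2 by norm_num]
    linarith
  have hK : 0 ≤ ‖hR.ind‖ * C := mul_nonneg (norm_nonneg _) ((norm_nonneg _).trans (hC 0))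
  have hfb : ∀ a, IsBddSeq fun n => f n a := fun a => ⟨_, fun n => hbound n a⟩
  have hq : ∀ a, S.q (fun n => f n a) = S.incl hR.ind * Einf (hR.e * S.incl a) := fun a => by
    have hl := he.mul (IsBddSeq.const a)
    have hr := (IsBddSeq.const a).mul he.star
    have hlr := (hl.condExp hE).add (hr.condExp hE)
    have h1 : S.q (fun n => f n a) = (1 / 2 : ℂ) • (S.incl hR.ind *
        (S.q (fun n => E ((e * fun _ => a : ℕ → A) n)) +
          S.q (fun n => E (((fun _ => a) * star e : ℕ → A) n)))) := by
      rw [SeqAlg.incl, ← S.q_add _ _ (hl.condExp hE) (hr.condExp hE),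
        ← S.q_mul _ _ (.const _) hlr, ← S.q_smul _ _ ((IsBddSeq.const _).mul hlr)]
      rfl
    rw [h1, ← hR.Einf_compat _ hl, ← hR.Einf_compat _ hr, S.q_mul _ _ he (.const a),
      S.q_mul _ _ (.const a) he.star, S.q_star _ he, hqe]
    change (1 / 2 : ℂ) • (S.incl hR.ind * (Einf (hR.e * S.incl a) +
      Einf (S.incl a * star hR.e))) = _
    rw [hR.compression_symm, ← two_smul ℂ (Einf _), mul_smul_comm, smul_smul]
    norm_num
  refine ⟨fun n => (f n).mkContinuous _ (hbound n), ‖hR.ind‖ * C,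
    fun n => LinearMap.mkContinuous_norm_le _ hK _, fun n a => ?_, fun n a => ?_, fun a b => ?_,
    fun p hp => ?_⟩
  · exact SMulMemClass.smul_mem _ (mul_mem hR.ind_mem (add_mem (hE.mem _) (hE.mem _)))
  · simp only [LinearMap.mkContinuous_apply, hf]
    have h2 : star (1 / 2 : ℂ) = 1 / 2 := by simp
    rw [star_smul, star_mul, (IsSelfAdjoint.of_nonneg hR.ind_pos).star_eq,
      ← (hR.ind_central _).eq, star_add, ← hE.star_map, ← hE.star_map, star_mul, star_mul,
      star_star, h2, add_comm]
  · refine (S.q_eq_q_iff (hfb _) ((hfb a).mul (hfb b))).1 ?_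
    rw [S.q_mul _ _ (hfb a) (hfb b), hq, hq, hq, hR.compression_mul]
  · refine (S.q_eq_q_iff (hfb _) (.const p)).1 ?_
    rw [hq, hR.compression_of_mem hp, SeqAlg.incl]

theorem eventually_isApproxHom {F A : Type*} [NormedRing F] [NormedAlgebra ℂ F]
    [FiniteDimensional ℂ F] [NormedRing A] [NormedAlgebra ℂ A] {φ : ℕ → F →L[ℂ] A}
    (hmul : ∀ a b, Tendsto (fun n => ‖φ n (a * b) - φ n a * φ n b‖) atTop (𝓝 0))
    (hone : Tendsto (fun n => ‖φ n 1 - 1‖) atTop (𝓝 0)) {δ : ℝ} (hδ : 0 < δ) :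
    ∀ᶠ n in atTop, IsApproxHom (φ n) δ := by
  let v := Module.finBasis ℂ F
  obtain ⟨C, hC, hCv⟩ := v.exists_opNorm_le (F := A)
  obtain ⟨D, hD, hDv⟩ := v.exists_opNorm_le (F := F →L[ℂ] A)
  let B : ℕ → F →L[ℂ] F →L[ℂ] A := fun n =>
    ContinuousLinearMap.compL ℂ F F A (φ n) ∘L ContinuousLinearMap.mul ℂ F -
      (ContinuousLinearMap.mul ℂ A).bilinearComp (φ n) (φ n)
  have hB : ∀ n a b, B n a b = φ n (a * b) - φ n a * φ n b := fun _ _ _ => rfl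
  have hM : 0 < δ / (D * C) := by positivity
  have h1 : ∀ᶠ n in atTop, ∀ i j, ‖B n (v i) (v j)‖ ≤ δ / (D * C) :=
    eventually_all.2 fun i => eventually_all.2 fun j => (hmul _ _).eventually_le_const hM
  filter_upwards [h1, hone.eventually_le_const hδ] with n hn hn1
  refine ⟨fun a b => ?_, hn1⟩
  have h2 : ‖B n‖ ≤ δ := by
    refine (hDv (by positivity) fun i => hCv hM.le fun j => hn i j).trans_eq ?_
    field_simp
  rw [← hB]
  refine ((B n).le_opNorm₂ a b).trans ?_
  gcongr

/-- If finitely many elements of `P` are close to a finite-dimensional C*-algebra mapping to `A`,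
they are close to a finite-dimensional C*-subalgebra of `P`. -/
theorem exists_finiteDimensional_near {F A : Type*} [CStarAlgebra F] [FiniteDimensional ℂ F]
    [CStarAlgebra A] {P : StarSubalgebra ℂ A} (hPc : IsClosed (P : Set A)) {φ : ℕ → A →L[ℂ] A}
    {K : ℝ} (hK : ∀ n, ‖φ n‖ ≤ K) (hP : ∀ n a, φ n a ∈ P)
    (hstar : ∀ n a, φ n (star a) = star (φ n a))
    (hmul : ∀ a b, Tendsto (fun n => ‖φ n (a * b) - φ n a * φ n b‖) atTop (𝓝 0))
    (hid : ∀ p ∈ P, Tendsto (fun n => ‖φ n p - p‖) atTop (𝓝 0))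
    (j : F →⋆ₐ[ℂ] A) {s : Finset A} (hs : ↑s ⊆ (P : Set A)) {y : A → F} {ε : ℝ} (hε : 0 < ε)
    (hy : ∀ x ∈ s, (K + 1) * ‖x - j (y x)‖ ≤ ε / 3) :
    ∃ R : StarSubalgebra ℂ A, R ≤ P ∧ FiniteDimensional ℂ R ∧ ∀ x ∈ s, ∃ z ∈ R, ‖x - z‖ < ε := by
  let J : F →L[ℂ] A := LinearMap.toContinuousLinearMap (j : F →ₗ[ℂ] A)
  have hJ : ∀ a, J a = j a := fun _ => rfl
  obtain ⟨L, ε₀, hL, hε₀, hnear⟩ := exists_starAlgHom_near (F := F) P hPc (K * ‖J‖)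
  let M : ℝ := ∑ x ∈ s, ‖y x‖
  have hM : ∀ x ∈ s, ‖y x‖ ≤ M := fun x hx =>
    Finset.single_le_sum (f := fun x => ‖y x‖) (fun _ _ => norm_nonneg _) hx
  have hM0 : 0 ≤ M := Finset.sum_nonneg fun _ _ => norm_nonneg _
  let δ := min ε₀ (ε / (3 * (L * M + 1)))
  have hδ : 0 < δ := lt_min hε₀ (by positivity)
  have hLδ : L * δ * M < ε / 3 := by
    have h : δ * (L * M + 1) ≤ ε / 3 := by
      refine (mul_le_mul_of_nonneg_right (min_le_right _ _) (by positivity)).trans_eq ?_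
      field_simp
    linarith
  have h1 : ∀ᶠ n in atTop, IsApproxHom (φ n ∘L J) δ := by
    refine eventually_isApproxHom (fun a b => ?_) ?_ hδ
    · simpa only [ContinuousLinearMap.comp_apply, hJ, map_mul] using hmul (j a) (j b)
    · simpa only [ContinuousLinearMap.comp_apply, hJ, map_one] using hid 1 (one_mem P)
  have h2 : ∀ᶠ n in atTop, ∀ x ∈ s, ‖φ n x - x‖ < ε / 3 :=
    (Filter.eventually_all_finset s).2 fun x hx =>
      (hid x (hs hx)).eventually_lt_const (by positivity)
  obtain ⟨n, hn1, hn2⟩ := (h1.and h2).exists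
  obtain ⟨π, hπP, hπ⟩ := hnear δ _ hδ.le (min_le_left _ _) hn1
    ((ContinuousLinearMap.opNorm_comp_le _ _).trans
      (mul_le_mul_of_nonneg_right (hK n) (norm_nonneg _)))
    (fun a => hP n _) (fun a => by
      simp only [ContinuousLinearMap.comp_apply, hJ, map_star, hstar])
  refine ⟨π.range, ?_, Module.Finite.of_surjective π.rangeRestrict.toAlgHom.toLinearMap ?_,
    fun x hx => ⟨π (y x), ⟨y x, rfl⟩, ?_⟩⟩
  · rintro _ ⟨a, rfl⟩
    exact hπP a
  · rintro ⟨_, a, rfl⟩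
    exact ⟨a, rfl⟩
  have h3 : ‖φ n x - φ n (j (y x))‖ ≤ ε / 3 := by
    rw [← map_sub]
    refine ((φ n).le_opNorm _).trans (le_trans ?_ (hy x hx))
    exact mul_le_mul_of_nonneg_right ((hK n).trans (by linarith)) (norm_nonneg _)
  have h4 : ‖φ n (j (y x)) - π (y x)‖ < ε / 3 :=
    ((hπ (y x)).trans (mul_le_mul_of_nonneg_left (hM x hx) (by positivity))).trans_lt hLδ
  have h5 := hn2 x hx
  calc ‖x - π (y x)‖
      = ‖-(φ n x - x) + (φ n x - φ n (j (y x))) + (φ n (j (y x)) - π (y x))‖ := by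
        congr 1
        abel
    _ ≤ ‖φ n x - x‖ + ‖φ n x - φ n (j (y x))‖ + ‖φ n (j (y x)) - π (y x)‖ :=
        (norm_add₃_le).trans_eq (by rw [norm_neg])
    _ < ε := by linarith

/-- A subalgebra of a unital AF algebra with the Rohlin property is AF. -/
theorem RohlinInclusion.isAFSubalgebra {A : Type*} [CStarAlgebra A] [PartialOrder A]
    [StarOrderedRing A] {P : StarSubalgebra ℂ A} {E : A → A} {Ainf : Type*} [Ring Ainf]
    [StarRing Ainf] [Algebra ℂ Ainf] {S : SeqAlg A Ainf} {Einf : Ainf → Ainf}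
    (hR : RohlinInclusion P E S Einf) (hAF : IsAFSubalgebra (⊤ : StarSubalgebra ℂ A)) :
    IsAFSubalgebra P := fun s hs ε hε => by
  obtain ⟨φ, K, hK, hP, hstar, hmul, hid⟩ := hR.exists_asymptotic_hom
  have hK0 : 0 ≤ K := (norm_nonneg _).trans (hK 0)
  obtain ⟨R, -, hRfin, hRs⟩ := hAF s (fun _ _ => Set.mem_univ _) (ε / (3 * (K + 1)))
    (by positivity)
  have hRc : IsClosed (R : Set A) :=
    Submodule.closed_of_finiteDimensional (Subalgebra.toSubmodule R.toSubalgebra)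
  let : CStarAlgebra R := StarSubalgebra.cstarAlgebra R (h_closed := hRc)
  have hex : ∀ x, ∃ y : R, x ∈ s → ‖x - y‖ < ε / (3 * (K + 1)) := fun x => by
    by_cases hx : x ∈ s
    · obtain ⟨y, hy, hxy⟩ := hRs x hx
      exact ⟨⟨y, hy⟩, fun _ => hxy⟩
    · exact ⟨0, fun h => absurd h hx⟩
  choose y hy using hex
  refine exists_finiteDimensional_near hR.condExp.isClosed hK hP hstar hmul hid R.subtype hs hε
    (y := y) fun x hx => ?_
  refine (mul_le_mul_of_nonneg_left (hy x hx).le (by positivity)).trans_eq ?_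
  field_simp

end

/-- let `P ⊆ A` be a finite-index inclusion of separable unital
C*-algebras with the Rohlin property. If `A` is an AF algebra, then `P` is an AF
algebra. -/
theorem rohlin_inclusion_AF
    {A : Type*} [NormedRing A] [StarRing A] [CStarRing A] [NormedAlgebra ℂ A]
    [CompleteSpace A] [StarModule ℂ A] [PartialOrder A] [StarOrderedRing A]
    [TopologicalSpace.SeparableSpace A]
    (P : StarSubalgebra ℂ A) (E : A → A)
    {Ainf : Type*} [Ring Ainf] [StarRing Ainf] [Algebra ℂ Ainf]
    (S : SeqAlg A Ainf) (Einf : Ainf → Ainf)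
    (hRohlin : RohlinInclusion P E S Einf)
    (hAF : IsAFSubalgebra (⊤ : StarSubalgebra ℂ A)) :
    IsAFSubalgebra P := by
  let : CStarAlgebra A := { }
  exact hRohlin.isAFSubalgebra hAF
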